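/- Let n ≥ 4 be an integer and let f ∈ C_c^∞(ℝⁿ \ {0}, ℂ). Then Re ⟨Δ_r f, Δ_s f⟩ ≥ 0, i.e. Re ∫_{ℝⁿ} (Δ_r f)(x) · conj((Δ_s f)(x)) dx ≥ 0. -/

import Mathlib

open MeasureTheory

noncomputable section

/-- Radial derivative `∂_r f (x) = (x/|x|)·∇f(x)`. -/
def radialDeriv (n : ℕ) (f : EuclideanSpace ℝ (Fin n) → ℂ)
    (x : EuclideanSpace ℝ (Fin n)) : ℂ :=
  fderiv ℝ f x (‖x‖⁻¹ • x)

/-- Radial Laplacian `Δ_r f = ∂_r(∂_r f) + ((n-1)/|x|) ∂_r f`. -/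
def radialLaplacian (n : ℕ) (f : EuclideanSpace ℝ (Fin n) → ℂ)
    (x : EuclideanSpace ℝ (Fin n)) : ℂ :=
  radialDeriv n (radialDeriv n f) x + (((n : ℝ) - 1) / ‖x‖) • radialDeriv n f x

/-- Euclidean Laplacian `Δ f = ∑ⱼ ∂ⱼ∂ⱼ f`. -/
def euclideanLaplacian (n : ℕ) (f : EuclideanSpace ℝ (Fin n) → ℂ)
    (x : EuclideanSpace ℝ (Fin n)) : ℂ :=
  ∑ j : Fin n,
    fderiv ℝ (fun y => fderiv ℝ f y (EuclideanSpace.single j 1)) x (EuclideanSpace.single j 1)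

/-- Spherical part `Δ_s f = Δ f − Δ_r f`. -/
def sphericalLaplacian (n : ℕ) (f : EuclideanSpace ℝ (Fin n) → ℂ)
    (x : EuclideanSpace ℝ (Fin n)) : ℂ :=
  euclideanLaplacian n f x - radialLaplacian n f x

/-- Spherical-type derivative `L_j f = ∂_j f − (x_j/|x|) ∂_r f`. -/
def sphericalDeriv (n : ℕ) (j : Fin n) (f : EuclideanSpace ℝ (Fin n) → ℂ)
    (x : EuclideanSpace ℝ (Fin n)) : ℂ :=
  fderiv ℝ f x (EuclideanSpace.single j 1) - (x j / ‖x‖) • radialDeriv n f x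

open scoped InnerProductSpace ContDiff

section

variable {n : ℕ}

/-- Smooth, compactly supported functions whose support avoids the origin. -/
structure IsPuncturedTest (f : EuclideanSpace ℝ (Fin n) → ℂ) : Prop where
  contDiff : ContDiff ℝ ∞ f
  hasCompactSupport : HasCompactSupport f
  zero_notMem : (0 : EuclideanSpace ℝ (Fin n)) ∉ tsupport f

/-- The derivative of `f` along the linear vector field `x ↦ A x`. -/
def linearFieldDeriv (A : EuclideanSpace ℝ (Fin n) →L[ℝ] EuclideanSpace ℝ (Fin n))
    (f : EuclideanSpace ℝ (Fin n) → ℂ) (x : EuclideanSpace ℝ (Fin n)) : ℂ :=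
  fderiv ℝ f x (A x)

/-- The Euler field derivative `x · ∇ f`. -/
def eulerDeriv (f : EuclideanSpace ℝ (Fin n) → ℂ) : EuclideanSpace ℝ (Fin n) → ℂ :=
  linearFieldDeriv (.id ℝ _) f

/-- The generator `x ↦ xᵢ eⱼ - xⱼ eᵢ` of rotations in the `(i, j)` plane. -/
def rotationGenerator (i j : Fin n) :
    EuclideanSpace ℝ (Fin n) →L[ℝ] EuclideanSpace ℝ (Fin n) :=
  (EuclideanSpace.proj i : EuclideanSpace ℝ (Fin n) →L[ℝ] ℝ).smulRight
      (EuclideanSpace.single j 1) -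
    (EuclideanSpace.proj j : EuclideanSpace ℝ (Fin n) →L[ℝ] ℝ).smulRight
      (EuclideanSpace.single i 1)

lemma rotationGenerator_apply (i j : Fin n) (x : EuclideanSpace ℝ (Fin n)) :
    rotationGenerator i j x =
      x i • EuclideanSpace.single j (1 : ℝ) - x j • EuclideanSpace.single i (1 : ℝ) := by
  simp [rotationGenerator]

/-- The density of the real inner product of `L²(‖x‖⁻⁴ dx)`. -/
def weightedInner (u v : EuclideanSpace ℝ (Fin n) → ℂ) (x : EuclideanSpace ℝ (Fin n)) : ℝ :=
  ((‖x‖ ^ 2)⁻¹) ^ 2 * ⟪u x, v x⟫_ℝ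

namespace IsPuncturedTest

variable {f u v : EuclideanSpace ℝ (Fin n) → ℂ}

lemma linearFieldDeriv (hf : IsPuncturedTest f)
    (A : EuclideanSpace ℝ (Fin n) →L[ℝ] EuclideanSpace ℝ (Fin n)) :
    IsPuncturedTest (linearFieldDeriv A f) := by
  have hs : tsupport (_root_.linearFieldDeriv A f) ⊆ tsupport f := by
    refine (closure_mono fun x hx => ?_).trans (tsupport_fderiv_subset ℝ (f := f))
    rw [Function.mem_support] at hx ⊢
    contrapose! hx
    simp [_root_.linearFieldDeriv, hx]
  refine ⟨?_, hf.hasCompactSupport.mono' (subset_closure.trans hs), fun h => hf.zero_notMem (hs h)⟩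
  exact (hf.contDiff.fderiv_right (m := ∞) (by simp)).clm_apply A.contDiff

lemma eulerDeriv (hf : IsPuncturedTest f) : IsPuncturedTest (eulerDeriv f) :=
  hf.linearFieldDeriv _

lemma contDiff_weightedInner (hu : IsPuncturedTest u) (hv : IsPuncturedTest v) :
    ContDiff ℝ ∞ (weightedInner u v) := by
  rw [contDiff_iff_contDiffAt]
  intro x
  by_cases hx : x = 0
  · subst hx
    have h : weightedInner u v =ᶠ[nhds 0] fun _ => 0 := by
      filter_upwards [notMem_tsupport_iff_eventuallyEq.1 hu.zero_notMem] with y hy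
      simp [weightedInner, hy]
    exact contDiffAt_const.congr_of_eventuallyEq h
  · refine ContDiffAt.mul ?_ (hu.contDiff.contDiffAt.inner ℝ hv.contDiff.contDiffAt)
    exact ((contDiff_norm_sq ℝ).contDiffAt.inv (by simpa using hx)).pow 2

lemma hasCompactSupport_weightedInner (hu : IsPuncturedTest u) :
    HasCompactSupport (weightedInner u v) :=
  hu.hasCompactSupport.mono fun x hx => by
    rw [Function.mem_support] at hx ⊢
    contrapose! hx
    simp [weightedInner, hx]

lemma integrable_weightedInner (hu : IsPuncturedTest u) (hv : IsPuncturedTest v) :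
    Integrable (weightedInner u v) :=
  (hu.contDiff_weightedInner hv).continuous.integrable_of_hasCompactSupport
    hu.hasCompactSupport_weightedInner

end IsPuncturedTest

lemma weightedInner_comm (u v : EuclideanSpace ℝ (Fin n) → ℂ) :
    weightedInner u v = weightedInner v u := by
  ext x
  simp only [weightedInner, real_inner_comm]

lemma integral_fderiv_linearField {h : EuclideanSpace ℝ (Fin n) → ℝ} (hh : ContDiff ℝ ∞ h)
    (hc : HasCompactSupport h)
    (A : EuclideanSpace ℝ (Fin n) →L[ℝ] EuclideanSpace ℝ (Fin n)) :
    ∫ x, fderiv ℝ h x (A x) =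
      -(∑ j, A (EuclideanSpace.single j 1) j) * ∫ x, h x := by
  have hD : Continuous (fderiv ℝ h) := hh.continuous_fderiv (by simp)
  have hexp : ∀ x, fderiv ℝ h x (A x) =
      ∑ j, (A x) j * fderiv ℝ h x (EuclideanSpace.single j 1) := by
    intro x
    conv_lhs => rw [← (EuclideanSpace.basisFun (Fin n) ℝ).sum_repr (A x)]
    simp
  have hcj : ∀ j, Continuous fun x => (A x) j := fun j => by fun_prop
  have hint : ∀ j, Integrable fun x => (A x) j * fderiv ℝ h x (EuclideanSpace.single j 1) :=
    fun j => ((hcj j).mul (hD.clm_apply continuous_const)).integrable_of_hasCompactSupport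
      ((hc.fderiv_apply ℝ _).mul_left)
  have hfd : ∀ j x, HasFDerivAt (fun x => (A x) j)
      ((EuclideanSpace.proj j : EuclideanSpace ℝ (Fin n) →L[ℝ] ℝ).comp A) x :=
    fun j x => ((EuclideanSpace.proj j : EuclideanSpace ℝ (Fin n) →L[ℝ] ℝ).comp A).hasFDerivAt
  have hhi : Integrable h := hh.continuous.integrable_of_hasCompactSupport hc
  simp_rw [hexp]
  rw [integral_finsetSum _ fun j _ => hint j, ← Finset.sum_neg_distrib, Finset.sum_mul]
  refine Finset.sum_congr rfl fun j _ => ?_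
  have hfe : ∀ x, fderiv ℝ (fun x => (A x) j) x (EuclideanSpace.single j 1) =
      A (EuclideanSpace.single j 1) j := fun x => by
    rw [(hfd j x).fderiv]; rfl
  rw [integral_mul_fderiv_eq_neg_fderiv_mul_of_integrable]
  · simp_rw [hfe, integral_const_mul, neg_mul]
  · simp_rw [hfe]
    exact hhi.const_mul _
  · exact hint j
  · exact ((hcj j).mul hh.continuous).integrable_of_hasCompactSupport hc.mul_left
  · exact fun x _ => (hfd j x).differentiableAt
  · exact fun x _ => hh.differentiable (by simp) x

lemma fderiv_weightedInner {u v : EuclideanSpace ℝ (Fin n) → ℂ} (hu : IsPuncturedTest u)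
    (hv : IsPuncturedTest v) {A : EuclideanSpace ℝ (Fin n) →L[ℝ] EuclideanSpace ℝ (Fin n)}
    {a : ℝ} (hA : ∀ x, ⟪x, A x⟫_ℝ = a * ‖x‖ ^ 2) (x : EuclideanSpace ℝ (Fin n)) :
    fderiv ℝ (weightedInner u v) x (A x) =
      weightedInner (linearFieldDeriv A u) v x + weightedInner u (linearFieldDeriv A v) x -
        4 * a * weightedInner u v x := by
  by_cases hx : x = 0
  · subst hx
    simp [weightedInner]
  · have hn : ‖x‖ ≠ 0 := by simpa using hx
    have hw := ((hasDerivAt_inv (pow_ne_zero 2 hn)).comp_hasFDerivAt x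
      (hasStrictFDerivAt_norm_sq x).hasFDerivAt).pow 2
    have hi := ((hu.contDiff.differentiable (by simp) x).hasFDerivAt).inner ℝ
      ((hv.contDiff.differentiable (by simp) x).hasFDerivAt)
    have h := (hw.mul hi).fderiv
    have h' : fderiv ℝ (weightedInner u v) x = _ := h
    rw [h']
    simp [weightedInner, linearFieldDeriv, hA]
    field_simp
    ring

lemma integral_weightedInner_linearFieldDeriv {u v : EuclideanSpace ℝ (Fin n) → ℂ}
    (hu : IsPuncturedTest u) (hv : IsPuncturedTest v)
    {A : EuclideanSpace ℝ (Fin n) →L[ℝ] EuclideanSpace ℝ (Fin n)}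
    {a : ℝ} (hA : ∀ x, ⟪x, A x⟫_ℝ = a * ‖x‖ ^ 2) :
    (∫ x, weightedInner (linearFieldDeriv A u) v x) =
      -(∫ x, weightedInner u (linearFieldDeriv A v) x) +
        (4 * a - ∑ j, A (EuclideanSpace.single j 1) j) * ∫ x, weightedInner u v x := by
  have h := integral_fderiv_linearField (hu.contDiff_weightedInner hv)
    hu.hasCompactSupport_weightedInner A
  simp_rw [fderiv_weightedInner hu hv hA] at h
  have i1 := (hu.linearFieldDeriv A).integrable_weightedInner hv
  have i2 := hu.integrable_weightedInner (hv.linearFieldDeriv A)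
  have i3 := (hu.integrable_weightedInner hv).const_mul (4 * a)
  have i12 : Integrable fun x => weightedInner (linearFieldDeriv A u) v x +
      weightedInner u (linearFieldDeriv A v) x := i1.add i2
  rw [integral_sub i12 i3, integral_add i1 i2, integral_const_mul] at h
  linarith

lemma integral_weightedInner_eulerDeriv {u v : EuclideanSpace ℝ (Fin n) → ℂ}
    (hu : IsPuncturedTest u) (hv : IsPuncturedTest v) :
    (∫ x, weightedInner (eulerDeriv u) v x) =
      -(∫ x, weightedInner u (eulerDeriv v) x) + (4 - n) * ∫ x, weightedInner u v x := by
  have h := integral_weightedInner_linearFieldDeriv hu hv (A := .id ℝ _) (a := 1)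
    (fun x => by simp)
  simpa [eulerDeriv] using h

lemma integral_weightedInner_rotation {u v : EuclideanSpace ℝ (Fin n) → ℂ}
    (hu : IsPuncturedTest u) (hv : IsPuncturedTest v) (i j : Fin n) :
    (∫ x, weightedInner (linearFieldDeriv (rotationGenerator i j) u) v x) =
      -(∫ x, weightedInner u (linearFieldDeriv (rotationGenerator i j) v) x) := by
  have h := integral_weightedInner_linearFieldDeriv hu hv (A := rotationGenerator i j) (a := 0)
    (fun x => by
      simp [rotationGenerator_apply, inner_sub_right, inner_smul_right,
        EuclideanSpace.inner_single_right]
      ring)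
  have ht : ∑ k, rotationGenerator i j (EuclideanSpace.single k 1) k = 0 := by
    refine Finset.sum_eq_zero fun k _ => ?_
    simp only [rotationGenerator_apply, PiLp.sub_apply, PiLp.smul_apply, PiLp.single_apply,
      smul_eq_mul]
    by_cases h1 : i = k <;> by_cases h2 : j = k <;> simp [h1, h2, eq_comm]
  rw [ht] at h
  simpa using h

lemma linearFieldDeriv_linearFieldDeriv {f : EuclideanSpace ℝ (Fin n) → ℂ} (hf : ContDiff ℝ ∞ f)
    (A B : EuclideanSpace ℝ (Fin n) →L[ℝ] EuclideanSpace ℝ (Fin n))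
    (x : EuclideanSpace ℝ (Fin n)) :
    linearFieldDeriv A (linearFieldDeriv B f) x =
      fderiv ℝ (fderiv ℝ f) x (A x) (B x) + fderiv ℝ f x (B (A x)) := by
  have hd : DifferentiableAt ℝ (fderiv ℝ f) x :=
    (hf.fderiv_right (m := 1) (by norm_cast)).differentiable (by simp) x
  have h := (hd.hasFDerivAt.clm_apply B.hasFDerivAt).fderiv
  have h' : fderiv ℝ (linearFieldDeriv B f) x = _ := h
  rw [linearFieldDeriv, h']
  simp [add_comm]

lemma linearFieldDeriv_eulerDeriv {f : EuclideanSpace ℝ (Fin n) → ℂ} (hf : ContDiff ℝ ∞ f)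
    (A : EuclideanSpace ℝ (Fin n) →L[ℝ] EuclideanSpace ℝ (Fin n)) :
    linearFieldDeriv A (eulerDeriv f) = eulerDeriv (linearFieldDeriv A f) := by
  ext x
  rw [eulerDeriv, eulerDeriv, linearFieldDeriv_linearFieldDeriv hf,
    linearFieldDeriv_linearFieldDeriv hf]
  have hs : IsSymmSndFDerivAt ℝ f x :=
    hf.contDiffAt.isSymmSndFDerivAt (by simp; norm_cast)
  rw [hs.eq]
  rfl

lemma radialDeriv_eq (f : EuclideanSpace ℝ (Fin n) → ℂ) (x : EuclideanSpace ℝ (Fin n)) :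
    radialDeriv n f x = ‖x‖⁻¹ • eulerDeriv f x := by
  simp [radialDeriv, eulerDeriv, linearFieldDeriv]

lemma radialLaplacian_eq {f : EuclideanSpace ℝ (Fin n) → ℂ} (hf : IsPuncturedTest f)
    (x : EuclideanSpace ℝ (Fin n)) :
    radialLaplacian n f x =
      (‖x‖ ^ 2)⁻¹ • (eulerDeriv (eulerDeriv f) x + ((n : ℝ) - 2) • eulerDeriv f x) := by
  by_cases hx : x = 0
  · subst hx
    simp [radialLaplacian, radialDeriv]
  · have hn : ‖x‖ ≠ 0 := by simpa using hx
    have hr : radialDeriv n f = fun y => ‖y‖⁻¹ • eulerDeriv f y := funext (radialDeriv_eq f)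
    have hnorm : HasFDerivAt (fun y : EuclideanSpace ℝ (Fin n) => ‖y‖)
        (fderiv ℝ (fun y : EuclideanSpace ℝ (Fin n) => ‖y‖) x) x :=
      (((contDiffAt_norm ℝ hx (n := 1)).differentiableAt (by simp))).hasFDerivAt
    have hxx : fderiv ℝ (fun y : EuclideanSpace ℝ (Fin n) => ‖y‖) x x = ‖x‖ :=
      (((contDiffAt_norm ℝ hx (n := 1)).differentiableAt (by simp))).fderiv_norm_self
    have hE := (hf.eulerDeriv.contDiff.differentiable (by simp) x).hasFDerivAt
    have h := (((hasDerivAt_inv hn).comp_hasFDerivAt x hnorm).smul hE).fderiv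
    have h' : fderiv ℝ (radialDeriv n f) x = _ := (congrArg (fderiv ℝ · x) hr).trans h
    have hee : eulerDeriv (eulerDeriv f) x = fderiv ℝ (eulerDeriv f) x x := rfl
    rw [radialLaplacian, radialDeriv, h', radialDeriv_eq, hee]
    simp only [map_smul, add_apply, smul_apply, ContinuousLinearMap.smulRight_apply, hxx,
      Function.comp_apply]
    simp only [Complex.real_smul, smul_eq_mul]
    have hnc : (‖x‖ : ℂ) ≠ 0 := by exact_mod_cast hn
    push_cast
    field_simp
    ring

lemma apply_apply_self_eq_sum (H : EuclideanSpace ℝ (Fin n) →L[ℝ] EuclideanSpace ℝ (Fin n) →L[ℝ] ℂ)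
    (x : EuclideanSpace ℝ (Fin n)) :
    H x x = ∑ i, ∑ j, (x i * x j) •
      H (EuclideanSpace.single i 1) (EuclideanSpace.single j 1) := by
  conv_lhs => rw [← (EuclideanSpace.basisFun (Fin n) ℝ).sum_repr x]
  simp [Finset.mul_sum, mul_assoc]
  rw [Finset.sum_comm]
  refine Finset.sum_congr rfl fun i _ => Finset.sum_congr rfl fun j _ => by ring

lemma sum_rotation_rotation {f : EuclideanSpace ℝ (Fin n) → ℂ} (hf : ContDiff ℝ ∞ f)
    (x : EuclideanSpace ℝ (Fin n)) :
    ∑ i, ∑ j, linearFieldDeriv (rotationGenerator i j)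
        (linearFieldDeriv (rotationGenerator i j) f) x =
      (2 : ℝ) • (‖x‖ ^ 2 • euclideanLaplacian n f x -
        (eulerDeriv (eulerDeriv f) x + ((n : ℝ) - 2) • eulerDeriv f x)) := by
  set H := fderiv ℝ (fderiv ℝ f) x with hH
  set e : Fin n → EuclideanSpace ℝ (Fin n) := fun j => EuclideanSpace.single j 1 with he
  set d : Fin n → ℂ := fun j => fderiv ℝ f x (e j) with hd
  have hdiff : DifferentiableAt ℝ (fderiv ℝ f) x :=
    (hf.fderiv_right (m := 1) (by norm_cast)).differentiable (by simp) x
  have hL : euclideanLaplacian n f x = ∑ j, H (e j) (e j) := by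
    refine Finset.sum_congr rfl fun j _ => ?_
    rw [fderiv_clm_apply hdiff (differentiableAt_const _)]
    simp [hH, he]
  have hEE : eulerDeriv (eulerDeriv f) x = H x x + fderiv ℝ f x x := by
    rw [eulerDeriv, eulerDeriv, linearFieldDeriv_linearFieldDeriv hf]
    rfl
  have hE : eulerDeriv f x = fderiv ℝ f x x := rfl
  have hx1 : fderiv ℝ f x x = ∑ j, x j • d j := by
    conv_lhs => enter [2]; rw [← (EuclideanSpace.basisFun (Fin n) ℝ).sum_repr x]
    simp [hd, he]
  have hterm : ∀ i j, linearFieldDeriv (rotationGenerator i j)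
      (linearFieldDeriv (rotationGenerator i j) f) x =
      ((x i ^ 2) • H (e j) (e j) + (x j ^ 2) • H (e i) (e i)
        - (x i * x j) • H (e i) (e j) - (x j * x i) • H (e j) (e i))
      + ((if i = j then (2 : ℝ) else 0) • (x j • d j) - x j • d j - x i • d i) := by
    intro i j
    rw [linearFieldDeriv_linearFieldDeriv hf, rotationGenerator_apply, rotationGenerator_apply]
    simp only [map_sub, map_smul, sub_apply, smul_apply,
      PiLp.sub_apply, PiLp.smul_apply, PiLp.single_apply, smul_eq_mul]
    simp only [Complex.real_smul, ← hH]
    by_cases hij : i = j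
    · subst hij
      simp
      ring
    · have hji : ¬ j = i := fun h => hij h.symm
      simp only [hij, hji, if_false, hd, he]
      push_cast
      ring
  have hnorm : ‖x‖ ^ 2 = ∑ i, x i ^ 2 := by
    rw [EuclideanSpace.norm_sq_eq]
    simp
  have hxx := apply_apply_self_eq_sum H x
  simp_rw [hterm, Finset.sum_add_distrib, Finset.sum_sub_distrib, Finset.sum_add_distrib]
  have s1 : ∑ i, ∑ j, (x i ^ 2) • H (e j) (e j) = ‖x‖ ^ 2 • ∑ j, H (e j) (e j) := by
    rw [hnorm, Finset.sum_smul]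
    simp_rw [Finset.smul_sum]
  have s2 : ∑ i, ∑ j, (x j ^ 2) • H (e i) (e i) = ‖x‖ ^ 2 • ∑ j, H (e j) (e j) := by
    rw [Finset.sum_comm, s1]
  have s3 : ∑ i, ∑ j, (x i * x j) • H (e i) (e j) = H x x := hxx.symm
  have s4 : ∑ i, ∑ j, (x j * x i) • H (e j) (e i) = H x x := by
    rw [Finset.sum_comm, s3]
  have s5 : ∑ i, ∑ j, (if i = j then (2 : ℝ) else 0) • (x j • d j) =
      (2 : ℝ) • fderiv ℝ f x x := by
    simp [hx1, ite_smul, Finset.smul_sum]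
  have s6 : ∑ _i : Fin n, ∑ j, x j • d j = (n : ℝ) • fderiv ℝ f x x := by
    simp [hx1]
  have s7 : ∑ i, ∑ _j : Fin n, x i • d i = (n : ℝ) • fderiv ℝ f x x := by
    rw [Finset.sum_comm, s6]
  rw [s1, s2, s3, s4, s5, s6, s7, hL, hEE, hE]
  module

lemma sphericalLaplacian_eq {f : EuclideanSpace ℝ (Fin n) → ℂ} (hf : IsPuncturedTest f)
    {x : EuclideanSpace ℝ (Fin n)} (hx : x ≠ 0) :
    sphericalLaplacian n f x =
      (‖x‖ ^ 2)⁻¹ • (2⁻¹ : ℝ) • ∑ i, ∑ j, linearFieldDeriv (rotationGenerator i j)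
        (linearFieldDeriv (rotationGenerator i j) f) x := by
  have hn : ‖x‖ ^ 2 ≠ 0 := by simpa using hx
  rw [sum_rotation_rotation hf.contDiff, sphericalLaplacian, radialLaplacian_eq hf,
    inv_smul_smul₀ two_ne_zero, smul_sub, inv_smul_smul₀ hn]

lemma integral_weightedInner_radial_rotation {f : EuclideanSpace ℝ (Fin n) → ℂ}
    (hf : IsPuncturedTest f) (i j : Fin n) :
    let g := linearFieldDeriv (rotationGenerator i j) f
    (∫ x, weightedInner (eulerDeriv (eulerDeriv f)) (linearFieldDeriv (rotationGenerator i j) g) x)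
      + ((n : ℝ) - 2) *
        (∫ x, weightedInner (eulerDeriv f) (linearFieldDeriv (rotationGenerator i j) g) x) =
      (∫ x, weightedInner (eulerDeriv g) (eulerDeriv g) x) +
        ((n : ℝ) - 4) * ∫ x, weightedInner g g x := by
  intro g
  have hg : IsPuncturedTest g := hf.linearFieldDeriv _
  have h1 := integral_weightedInner_rotation hf.eulerDeriv.eulerDeriv hg i j
  have h2 := integral_weightedInner_rotation hf.eulerDeriv hg i j
  rw [linearFieldDeriv_eulerDeriv hf.eulerDeriv.contDiff,
    linearFieldDeriv_eulerDeriv hf.contDiff] at h1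
  rw [linearFieldDeriv_eulerDeriv hf.contDiff] at h2
  have h3 := integral_weightedInner_eulerDeriv hg.eulerDeriv hg
  have h4 := integral_weightedInner_eulerDeriv hg hg
  rw [weightedInner_comm g (eulerDeriv g)] at h4
  change (∫ x, weightedInner (eulerDeriv (eulerDeriv g)) g x) = _ at h1
  change (∫ x, weightedInner (eulerDeriv g) g x) = _ at h2
  linear_combination h1 + ((n : ℝ) - 2) * h2 - h3 - h4

lemma re_radialLaplacian_mul_conj_sphericalLaplacian {f : EuclideanSpace ℝ (Fin n) → ℂ}
    (hf : IsPuncturedTest f) (x : EuclideanSpace ℝ (Fin n)) :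
    (radialLaplacian n f x * (starRingEnd ℂ) (sphericalLaplacian n f x)).re =
      2⁻¹ * ∑ i, ∑ j,
        (weightedInner (eulerDeriv (eulerDeriv f)) (linearFieldDeriv (rotationGenerator i j)
            (linearFieldDeriv (rotationGenerator i j) f)) x +
          ((n : ℝ) - 2) * weightedInner (eulerDeriv f) (linearFieldDeriv (rotationGenerator i j)
            (linearFieldDeriv (rotationGenerator i j) f)) x) := by
  by_cases hx : x = 0
  · subst hx
    rw [radialLaplacian_eq hf]
    simp [weightedInner]
  · have h : ∀ z w : ℂ, (z * (starRingEnd ℂ) w).re = ⟪z, w⟫_ℝ := fun z w => by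
      rw [real_inner_comm, Complex.inner, mul_comm]
    rw [h, radialLaplacian_eq hf, sphericalLaplacian_eq hf hx]
    simp only [real_inner_smul_left, real_inner_smul_right, inner_sum, weightedInner,
      inner_add_left, Finset.mul_sum]
    refine Finset.sum_congr rfl fun i _ => Finset.sum_congr rfl fun j _ => ?_
    ring

end

/-- Evans–Lewis: for `n ≥ 4` and `f ∈ C_c^∞(ℝⁿ \ {0})`, `Re ⟨Δ_r f, Δ_s f⟩ ≥ 0`. -/
theorem radial_spherical_angle (n : ℕ) (hn : 4 ≤ n) (f : EuclideanSpace ℝ (Fin n) → ℂ)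
    (hf : ContDiff ℝ (⊤ : ℕ∞) f) (hsupp : HasCompactSupport f)
    (h0 : (0 : EuclideanSpace ℝ (Fin n)) ∉ tsupport f) :
    0 ≤ (∫ x : EuclideanSpace ℝ (Fin n),
      radialLaplacian n f x * (starRingEnd ℂ) (sphericalLaplacian n f x)).re := by
  have hT : IsPuncturedTest f := ⟨hf, hsupp, h0⟩
  by_cases hint : Integrable fun x : EuclideanSpace ℝ (Fin n) =>
      radialLaplacian n f x * (starRingEnd ℂ) (sphericalLaplacian n f x)
  swap
  · simp [integral_undef hint]
  have hre := Complex.reCLM.integral_comp_comm hint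
  simp only [Complex.reCLM_apply] at hre
  rw [← hre]
  simp_rw [re_radialLaplacian_mul_conj_sphericalLaplacian hT]
  have hLL : ∀ i j, IsPuncturedTest (linearFieldDeriv (rotationGenerator i j)
      (linearFieldDeriv (rotationGenerator i j) f)) :=
    fun i j => (hT.linearFieldDeriv _).linearFieldDeriv _
  have i1 := fun i j => hT.eulerDeriv.eulerDeriv.integrable_weightedInner (hLL i j)
  have i2 := fun i j =>
    (hT.eulerDeriv.integrable_weightedInner (hLL i j)).const_mul ((n : ℝ) - 2)
  have i12 : ∀ i j, Integrable fun x =>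
      weightedInner (eulerDeriv (eulerDeriv f)) (linearFieldDeriv (rotationGenerator i j)
          (linearFieldDeriv (rotationGenerator i j) f)) x +
        ((n : ℝ) - 2) * weightedInner (eulerDeriv f) (linearFieldDeriv (rotationGenerator i j)
          (linearFieldDeriv (rotationGenerator i j) f)) x := fun i j => (i1 i j).add (i2 i j)
  rw [integral_const_mul, integral_finsetSum _ fun i _ =>
    integrable_finsetSum _ fun j _ => i12 i j]
  refine mul_nonneg (by norm_num) (Finset.sum_nonneg fun i _ => ?_)
  rw [integral_finsetSum _ fun j _ => i12 i j]
  refine Finset.sum_nonneg fun j _ => ?_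
  rw [integral_add (i1 i j) (i2 i j), integral_const_mul,
    integral_weightedInner_radial_rotation hT i j]
  have hpos : ∀ u : EuclideanSpace ℝ (Fin n) → ℂ, 0 ≤ ∫ x, weightedInner u u x := fun u =>
    integral_nonneg fun x => mul_nonneg (by positivity) real_inner_self_nonneg
  have hn' : (0 : ℝ) ≤ (n : ℝ) - 4 := by
    have : (4 : ℝ) ≤ n := by exact_mod_cast hn
    linarith
  exact add_nonneg (hpos _) (mul_nonneg hn' (hpos _))
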